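/- Let k, n be positive integers with k < n, and let p₀,…,p_k ∈ ℝ^{1,n} be (k+1) points in general position. Then the Lorentzian distance-squared mapping L_{(p₀,…,p_k)} is A-equivalent to the Euclidean distance-squared mapping D_{(p₀,…,p_k)} if and only if the recognition subspace V(p₀,…,p_k) is time-like. -/

import Mathlib

open scoped BigOperators

noncomputable section

/-- The Lorentzian inner product on `ℝ^{1,n}`, modeled as `Fin (n+1) → ℝ`:
`⟨x,y⟩ = -x₀y₀ + x₁y₁ + ⋯ + xₙyₙ`. -/
def lorIP {n : ℕ} (x y : Fin (n + 1) → ℝ) : ℝ :=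
  (∑ i, x i * y i) - 2 * (x 0 * y 0)

/-- The Euclidean inner product on `Fin m → ℝ`. -/
def eucIP {m : ℕ} (x y : Fin m → ℝ) : ℝ := ∑ i, x i * y i

/-- The Lorentzian distance-squared mapping determined by the points `p 0, …, p (m-1)`. -/
def LorDSM {n m : ℕ} (p : Fin m → Fin (n + 1) → ℝ) :
    (Fin (n + 1) → ℝ) → (Fin m → ℝ) :=
  fun x i => lorIP (x - p i) (x - p i)

/-- The Euclidean distance-squared mapping determined by the points `p 0, …, p (m-1)`. -/
def EucDSM {n m : ℕ} (p : Fin m → Fin (n + 1) → ℝ) :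
    (Fin (n + 1) → ℝ) → (Fin m → ℝ) :=
  fun x i => eucIP (x - p i) (x - p i)

/-- The recognition subspace `V(p₀, …, p_k)`: the span of the vectors `p i - p 0`. -/
def recSub {n k : ℕ} (p : Fin (k + 1) → Fin (n + 1) → ℝ) :
    Submodule ℝ (Fin (n + 1) → ℝ) :=
  Submodule.span ℝ (Set.range fun i => p i - p 0)

/-- The partial recognition subspace `V(p₀, …, p_j)`: the span of `p i - p 0` for `i ≤ j`. -/
def recSubUpTo {n k : ℕ} (p : Fin (k + 1) → Fin (n + 1) → ℝ) (j : ℕ) :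
    Submodule ℝ (Fin (n + 1) → ℝ) :=
  Submodule.span ℝ {v | ∃ i : Fin (k + 1), (i : ℕ) ≤ j ∧ v = p i - p 0}

/-- A subspace is time-like iff it contains a vector of negative Lorentzian square. -/
def LTimeLike {n : ℕ} (V : Submodule ℝ (Fin (n + 1) → ℝ)) : Prop :=
  ∃ v ∈ V, lorIP v v < 0

/-- A subspace is space-like iff every nonzero vector in it has positive Lorentzian square. -/
def LSpaceLike {n : ℕ} (V : Submodule ℝ (Fin (n + 1) → ℝ)) : Prop :=
  ∀ v ∈ V, v ≠ 0 → 0 < lorIP v v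

/-- A subspace is light-like iff it is neither time-like nor space-like. -/
def LLightLike {n : ℕ} (V : Submodule ℝ (Fin (n + 1) → ℝ)) : Prop :=
  ¬ LTimeLike V ∧ ¬ LSpaceLike V

/-- `f` and `g` are `𝒜`-equivalent: `g = H ∘ f ∘ h` for `C^∞` diffeomorphisms `h, H`. -/
def AEquiv {a b : ℕ} (f g : (Fin a → ℝ) → (Fin b → ℝ)) : Prop :=
  ∃ (h : (Fin a → ℝ) ≃ (Fin a → ℝ)) (H : (Fin b → ℝ) ≃ (Fin b → ℝ)),
    ContDiff ℝ (⊤ : ℕ∞) ⇑h ∧ ContDiff ℝ (⊤ : ℕ∞) ⇑h.symm ∧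
    ContDiff ℝ (⊤ : ℕ∞) ⇑H ∧ ContDiff ℝ (⊤ : ℕ∞) ⇑H.symm ∧
    g = ⇑H ∘ f ∘ ⇑h

/-- The Lorentzian inner product as a bilinear form. -/
def lorForm (n : ℕ) : LinearMap.BilinForm ℝ (Fin (n + 1) → ℝ) :=
  LinearMap.mk₂ ℝ lorIP
    (fun x y z => by simp only [lorIP, Pi.add_apply, add_mul, Finset.sum_add_distrib]; ring)
    (fun c x y => by
      simp only [lorIP, Pi.smul_apply, smul_eq_mul, mul_assoc, ← Finset.mul_sum]; ring)
    (fun x y z => by simp only [lorIP, Pi.add_apply, mul_add, Finset.sum_add_distrib]; ring)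
    (fun c x y => by
      simp only [lorIP, Pi.smul_apply, smul_eq_mul, mul_left_comm _ c, ← Finset.mul_sum]; ring)

/-- The Euclidean inner product as a bilinear form. -/
def eucForm (m : ℕ) : LinearMap.BilinForm ℝ (Fin m → ℝ) :=
  LinearMap.mk₂ ℝ eucIP
    (fun x y z => by simp only [eucIP, Pi.add_apply, add_mul, Finset.sum_add_distrib])
    (fun c x y => by simp only [eucIP, Pi.smul_apply, smul_eq_mul, mul_assoc, ← Finset.mul_sum])
    (fun x y z => by simp only [eucIP, Pi.add_apply, mul_add, Finset.sum_add_distrib])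
    (fun c x y => by
      simp only [eucIP, Pi.smul_apply, smul_eq_mul, mul_left_comm _ c, ← Finset.mul_sum])

theorem lorForm_apply {n : ℕ} (x y : Fin (n + 1) → ℝ) : lorForm n x y = lorIP x y := rfl

theorem eucForm_apply {m : ℕ} (x y : Fin m → ℝ) : eucForm m x y = eucIP x y := rfl

theorem lorForm_isSymm (n : ℕ) : (lorForm n).IsSymm :=
  ⟨fun x y => by simp only [lorForm_apply, lorIP, mul_comm]⟩

theorem eucForm_isSymm (m : ℕ) : (eucForm m).IsSymm :=
  ⟨fun x y => by simp only [eucForm_apply, eucIP, mul_comm]⟩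

theorem lorIP_eq {n : ℕ} (x y : Fin (n + 1) → ℝ) :
    lorIP x y = -(x 0 * y 0) + ∑ i : Fin n, x i.succ * y i.succ := by
  rw [lorIP, Fin.sum_univ_succ]; ring

theorem eucIP_self_pos {m : ℕ} {x : Fin m → ℝ} (hx : x ≠ 0) : 0 < eucIP x x := by
  obtain ⟨i, hi⟩ := Function.ne_iff.mp hx
  exact Finset.sum_pos' (fun j _ => mul_self_nonneg (x j))
    ⟨i, Finset.mem_univ i, mul_self_pos.mpr hi⟩

theorem eucIP_self_nonneg {m : ℕ} (x : Fin m → ℝ) : 0 ≤ eucIP x x :=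
  Finset.sum_nonneg fun i _ => mul_self_nonneg (x i)

theorem lorForm_nondegenerate (n : ℕ) : (lorForm n).Nondegenerate := by
  refine (lorForm_isSymm n).isRefl.nondegenerate_iff_separatingLeft.mpr ?_
  intro x hx
  ext i
  have h := hx (Pi.single i 1)
  rw [lorForm_apply, lorIP] at h
  simp only [Pi.single_apply, mul_ite, mul_one, mul_zero, Finset.sum_ite_eq',
    Finset.mem_univ, if_true] at h
  by_cases h0 : (0 : Fin (n + 1)) = i
  · subst h0
    simp only [if_true] at h
    simp only [Pi.zero_apply]
    linarith
  · simpa [h0] using h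

theorem eucForm_nondegenerate (m : ℕ) : (eucForm m).Nondegenerate := by
  refine (eucForm_isSymm m).isRefl.nondegenerate_iff_separatingLeft.mpr ?_
  intro x hx
  by_contra h
  exact (eucIP_self_pos h).ne' (hx x)

/-- A nonzero vector Lorentz-orthogonal to a time-like vector is space-like. -/
theorem lorIP_self_pos_of_orthogonal {n : ℕ} {v w : Fin (n + 1) → ℝ} (hv : lorIP v v < 0)
    (hvw : lorIP v w = 0) (hw : w ≠ 0) : 0 < lorIP w w := by
  by_contra! hle
  have hcs := Finset.sum_mul_sq_le_sq_mul_sq Finset.univ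
    (fun i : Fin n => v i.succ) (fun i : Fin n => w i.succ)
  have hb : (0 : ℝ) ≤ ∑ i : Fin n, w i.succ ^ 2 := Finset.sum_nonneg fun i _ => sq_nonneg _
  have ha : (0 : ℝ) ≤ ∑ i : Fin n, v i.succ ^ 2 := Finset.sum_nonneg fun i _ => sq_nonneg _
  simp only [lorIP_eq, ← sq] at hv hvw hle
  have h1 : ∑ i : Fin n, v i.succ * w i.succ = v 0 * w 0 := by linarith
  rw [h1] at hcs
  have h0 : w 0 = 0 := by
    by_contra h0
    have : 0 < w 0 ^ 2 := by positivity
    nlinarith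
  have hsum : ∑ i : Fin n, w i.succ ^ 2 = 0 := by rw [h0] at hle; linarith
  rw [Finset.sum_eq_zero_iff_of_nonneg fun i _ => sq_nonneg _] at hsum
  refine hw (funext fun i => ?_)
  refine Fin.cases h0 (fun j => ?_) i
  simpa using hsum j (Finset.mem_univ j)

/-- If a subspace of dimension less than `n` is not time-like, its Lorentzian orthogonal complement
contains a nonzero null vector. -/
theorem exists_null_mem_orthogonal {n : ℕ} (V : Submodule ℝ (Fin (n + 1) → ℝ))
    (hdim : Module.finrank ℝ V < n) (hV : ¬ LTimeLike V) :
    ∃ u ∈ (lorForm n).orthogonal V, u ≠ 0 ∧ lorForm n u u = 0 := by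
  set B := lorForm n with hB
  have hsymm : ∀ x y, B x y = B y x := fun x y => (lorForm_isSymm n).eq x y
  have hrank : 2 ≤ Module.finrank ℝ (B.orthogonal V) := by
    rw [LinearMap.BilinForm.finrank_orthogonal (lorForm_nondegenerate n), Module.finrank_fin_fun]
    omega
  obtain ⟨z, hzW, hz, hzpos⟩ : ∃ z ∈ B.orthogonal V, z ≠ 0 ∧ 0 < B z z := by
    let f : B.orthogonal V →ₗ[ℝ] ℝ := (LinearMap.proj 0).comp (B.orthogonal V).subtype
    have hker : LinearMap.ker f ≠ ⊥ :=
      LinearMap.ker_ne_bot_of_finrank_lt (by rw [Module.finrank_self]; omega)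
    obtain ⟨z, hz, hz0⟩ := Submodule.exists_mem_ne_zero_of_ne_bot hker
    have hzne : (z : Fin (n + 1) → ℝ) ≠ 0 := by simpa using hz0
    refine ⟨z, z.2, hzne, ?_⟩
    have h0 : (z : Fin (n + 1) → ℝ) 0 = 0 := hz
    have := eucIP_self_pos hzne
    change 0 < lorIP _ _
    rw [lorIP, h0]
    simpa [eucIP] using this
  obtain ⟨w, hwW, hw, hwle⟩ : ∃ w ∈ B.orthogonal V, w ≠ 0 ∧ B w w ≤ 0 := by
    by_contra! hpos
    have hcompl : IsCompl V (B.orthogonal V) := by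
      rw [LinearMap.BilinForm.isCompl_orthogonal_iff_disjoint (lorForm_isSymm n).isRefl,
        Submodule.disjoint_def]
      intro x hxV hxW
      by_contra hx
      exact (hpos x hxW hx).ne' (hxW x hxV)
    let e : Fin (n + 1) → ℝ := Pi.single 0 1
    have he : B e e = -1 := by
      rw [hB, lorForm_apply, lorIP_eq]
      simp [e]
    obtain ⟨v, hv, w, hw, hvw⟩ := Submodule.mem_sup.mp
      (hcompl.sup_eq_top ▸ Submodule.mem_top : e ∈ V ⊔ B.orthogonal V)
    have h1 : 0 ≤ B v v := by
      by_contra! h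
      exact hV ⟨v, hv, h⟩
    have h2 : 0 ≤ B w w := by
      by_cases h : w = 0
      · simp [h]
      · exact (hpos w hw h).le
    have h3 : B v w = 0 := hw v hv
    have h4 : B w v = 0 := by rw [hsymm, h3]
    rw [← hvw] at he
    simp only [map_add, LinearMap.add_apply, h3, h4] at he
    linarith
  obtain ⟨t, ht⟩ : ∃ t : ℝ, B (w + t • z) (w + t • z) = 0 := by
    have hd : 0 ≤ B w z ^ 2 - B z z * B w w := by nlinarith [sq_nonneg (B w z)]
    refine ⟨(-B w z + √(B w z ^ 2 - B z z * B w w)) / B z z, ?_⟩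
    simp only [map_add, map_smul, LinearMap.add_apply, LinearMap.smul_apply, smul_eq_mul,
      hsymm z w]
    have hs := Real.sq_sqrt hd
    generalize √(B w z ^ 2 - B z z * B w w) = r at hs
    field_simp
    linear_combination hs
  by_cases hne : w + t • z = 0
  · have hwz : w = (-t) • z := by rw [neg_smul]; exact eq_neg_of_add_eq_zero_left hne
    have : t ≠ 0 := by
      rintro rfl
      exact hw (by simpa using hwz)
    have h2 : 0 < t ^ 2 := by positivity
    rw [hwz] at hwle
    simp only [map_smul, LinearMap.smul_apply, smul_eq_mul] at hwle
    nlinarith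
  · exact ⟨_, add_mem hwW (Submodule.smul_mem _ t hzW), hne, ht⟩

theorem LorDSM_apply_eq {n m : ℕ} (p : Fin (m + 1) → Fin (n + 1) → ℝ) (x : Fin (n + 1) → ℝ)
    (i : Fin (m + 1)) :
    LorDSM p x i = lorForm n (x - p 0) (x - p 0) - 2 * lorForm n (x - p 0) (p i - p 0) +
      lorForm n (p i - p 0) (p i - p 0) := by
  have h : x - p i = (x - p 0) - (p i - p 0) := by abel
  have hs : lorForm n (p i - p 0) (x - p 0) = lorForm n (x - p 0) (p i - p 0) :=
    (lorForm_isSymm n).eq _ _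
  rw [LorDSM, ← lorForm_apply, h]
  generalize x - p 0 = y at hs ⊢
  generalize p i - p 0 = v at hs ⊢
  simp only [map_sub, LinearMap.sub_apply, hs]
  ring

theorem EucDSM_apply_eq {n m : ℕ} (p : Fin (m + 1) → Fin (n + 1) → ℝ) (x : Fin (n + 1) → ℝ)
    (i : Fin (m + 1)) :
    EucDSM p x i = eucForm _ (x - p 0) (x - p 0) - 2 * eucForm _ (x - p 0) (p i - p 0) +
      eucForm _ (p i - p 0) (p i - p 0) := by
  have h : x - p i = (x - p 0) - (p i - p 0) := by abel
  have hs : eucForm _ (p i - p 0) (x - p 0) = eucForm _ (x - p 0) (p i - p 0) :=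
    (eucForm_isSymm _).eq _ _
  rw [EucDSM, ← eucForm_apply, h]
  generalize x - p 0 = y at hs ⊢
  generalize p i - p 0 = v at hs ⊢
  simp only [map_sub, LinearMap.sub_apply, hs]
  ring

theorem linearIndependent_of_finrank_recSub {n k : ℕ} {p : Fin (k + 1) → Fin (n + 1) → ℝ}
    (hgen : Module.finrank ℝ (recSub p) = k) :
    LinearIndependent ℝ fun i : Fin k => p i.succ - p 0 := by
  rw [linearIndependent_iff_card_eq_finrank_span, Fintype.card_fin, Set.finrank]
  have h : recSub p = Submodule.span ℝ (Set.range fun i : Fin k => p i.succ - p 0) := by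
    apply le_antisymm
    · rw [recSub, Submodule.span_le]
      rintro _ ⟨i, rfl⟩
      refine Fin.cases ?_ (fun j => ?_) i
      · simp
      · exact Submodule.subset_span ⟨j, rfl⟩
    · apply Submodule.span_mono
      rintro _ ⟨i, rfl⟩
      exact ⟨i.succ, rfl⟩
  rw [← h, hgen]

/-- A linearly independent family can be given prescribed products against some vector. -/
theorem exists_lorForm_eq {n k : ℕ} {v : Fin k → Fin (n + 1) → ℝ} (hv : LinearIndependent ℝ v)
    (a : Fin k → ℝ) : ∃ y, ∀ i, lorForm n y (v i) = a i := by
  obtain ⟨f, hf⟩ := LinearMap.exists_extend ((Module.Basis.span hv).constr ℝ a)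
  refine ⟨((lorForm n).toDual (lorForm_nondegenerate n)).symm f, fun i => ?_⟩
  rw [LinearMap.BilinForm.apply_toDual_symm_apply]
  have h := LinearMap.congr_fun hf (Module.Basis.span hv i)
  rw [Module.Basis.constr_basis] at h
  rw [← h, LinearMap.comp_apply, Submodule.subtype_apply, Module.Basis.span_apply]

/-- If the recognition subspace is not time-like, the Lorentzian distance-squared mapping has
dense image. -/
theorem denseRange_LorDSM {k n : ℕ} (hkn : k < n) (p : Fin (k + 1) → Fin (n + 1) → ℝ)
    (hgen : Module.finrank ℝ (recSub p) = k) (hV : ¬ LTimeLike (recSub p)) :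
    DenseRange (LorDSM p) := by
  obtain ⟨u, huW, hu, huu⟩ := exists_null_mem_orthogonal (recSub p) (by omega) hV
  have hmem : ∀ (y : Fin (n + 1) → ℝ) (s : ℝ), lorForm n y u ≠ 0 →
      (fun i => s - 2 * lorForm n y (p i - p 0) + lorForm n (p i - p 0) (p i - p 0)) ∈
        Set.range (LorDSM p) := by
    intro y s hyu
    have huv : ∀ i, lorForm n u (p i - p 0) = 0 := fun i => by
      rw [← (lorForm_isSymm n).eq]
      exact huW _ (Submodule.subset_span ⟨i, rfl⟩)
    have huy : lorForm n u y = lorForm n y u := (lorForm_isSymm n).eq _ _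
    refine ⟨y + ((s - lorForm n y y) / (2 * lorForm n y u)) • u + p 0, funext fun i => ?_⟩
    rw [LorDSM_apply_eq, add_sub_cancel_right]
    simp only [map_add, map_smul, LinearMap.add_apply, LinearMap.smul_apply, smul_eq_mul,
      huv, huy, huu]
    field_simp
    ring
  intro c
  obtain ⟨y, hy⟩ := exists_lorForm_eq (linearIndependent_of_finrank_recSub hgen)
    (fun i => (c 0 - c i.succ + lorForm n (p i.succ - p 0) (p i.succ - p 0)) / 2)
  have hc : ∀ i, c 0 - 2 * lorForm n y (p i - p 0) + lorForm n (p i - p 0) (p i - p 0) = c i := by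
    intro i
    refine Fin.cases ?_ (fun j => ?_) i
    · simp
    · rw [hy]; ring
  by_cases hyu : lorForm n y u = 0
  · obtain ⟨z, hz⟩ : ∃ z, lorForm n z u ≠ 0 := by
      by_contra! h
      exact hu ((lorForm_nondegenerate n).2 u h)
    refine mem_closure_of_tendsto (b := nhdsWithin (0 : ℝ) {0}ᶜ)
      (f := fun t : ℝ => fun i : Fin (k + 1) => c 0 - 2 * lorForm n (y + t • z) (p i - p 0) +
        lorForm n (p i - p 0) (p i - p 0)) ?_ ?_
    · refine tendsto_nhdsWithin_of_tendsto_nhds (tendsto_pi_nhds.mpr fun i => ?_)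
      have hcont : Continuous fun t : ℝ => c 0 - 2 * lorForm n (y + t • z) (p i - p 0) +
          lorForm n (p i - p 0) (p i - p 0) := by
        simp only [map_add, map_smul, LinearMap.add_apply, LinearMap.smul_apply, smul_eq_mul]
        fun_prop
      have := hcont.tendsto 0
      rwa [zero_smul, add_zero, hc] at this
    · filter_upwards [self_mem_nhdsWithin] with t ht
      refine hmem _ _ ?_
      simp only [map_add, map_smul, LinearMap.add_apply, LinearMap.smul_apply, smul_eq_mul,
        hyu, zero_add]
      exact mul_ne_zero ht hz
  · have := hmem y (c 0) hyu
    rw [funext hc] at this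
    exact subset_closure this

theorem not_denseRange_EucDSM {n m : ℕ} (p : Fin (m + 1) → Fin (n + 1) → ℝ) :
    ¬ DenseRange (EucDSM p) := by
  intro h
  obtain ⟨x, hx⟩ := h.exists_mem_open
    (isOpen_lt (continuous_apply (0 : Fin (m + 1))) (continuous_const (y := (0 : ℝ))))
    ⟨fun _ => -1, by simp⟩
  exact absurd hx (not_lt.mpr (eucIP_self_nonneg _))

/-- A positive definite real quadratic form is equivalent to a sum of squares. -/
theorem QuadraticForm.PosDef.equivalent_weightedSumSquares_one {M : Type*} [AddCommGroup M]
    [Module ℝ M] [FiniteDimensional ℝ M] {Q : QuadraticForm ℝ M} (hQ : Q.PosDef) :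
    Q.Equivalent (QuadraticMap.weightedSumSquares ℝ
      (fun _ : Fin (Module.finrank ℝ M) => (1 : ℝ))) := by
  obtain ⟨w, hw, ⟨e⟩⟩ := QuadraticForm.equivalent_one_zero_neg_one_weighted_sum_squared Q
  have hw1 : w = fun _ => 1 := by
    funext i
    have hne : e.symm (Pi.single i 1) ≠ 0 := by
      intro h
      have : (Pi.single i 1 : Fin (Module.finrank ℝ M) → ℝ) = 0 := by
        rw [← e.apply_symm_apply (Pi.single i 1), h]
        exact map_zero e.toLinearEquiv
      simpa using congrFun this i
    have hpos := hQ _ hne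
    rw [e.symm.map_app, QuadraticMap.weightedSumSquares_apply] at hpos
    simp [Pi.single_apply] at hpos
    rcases hw i with h | h | h <;> linarith
  exact ⟨hw1 ▸ e⟩

/-- Positive definite real quadratic forms on spaces of the same dimension are equivalent. -/
theorem QuadraticForm.PosDef.equivalent {M N : Type*} [AddCommGroup M] [Module ℝ M]
    [FiniteDimensional ℝ M] [AddCommGroup N] [Module ℝ N] [FiniteDimensional ℝ N]
    {Q : QuadraticForm ℝ M} {Q' : QuadraticForm ℝ N} (hQ : Q.PosDef) (hQ' : Q'.PosDef)
    (h : Module.finrank ℝ M = Module.finrank ℝ N) : Q.Equivalent Q' := by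
  have h1 := QuadraticForm.PosDef.equivalent_weightedSumSquares_one hQ
  rw [h] at h1
  exact h1.trans (QuadraticForm.PosDef.equivalent_weightedSumSquares_one hQ').symm

/-- If `V` is time-like, some linear automorphism carries Euclidean products against `V` to
Lorentzian ones, and changes the square of a vector only through its component along `V`. -/
theorem exists_linearEquiv_of_timeLike {n : ℕ} (V : Submodule ℝ (Fin (n + 1) → ℝ))
    (hV : LTimeLike V) :
    ∃ (h : (Fin (n + 1) → ℝ) ≃ₗ[ℝ] (Fin (n + 1) → ℝ))
      (P : (Fin (n + 1) → ℝ) →ₗ[ℝ] V) (T : V →ₗ[ℝ] V),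
      (∀ y, ∀ v ∈ V, lorForm n (h y) v = eucForm (n + 1) y v) ∧
      (∀ y, ∀ v ∈ V, eucForm (n + 1) (P y) v = eucForm (n + 1) y v) ∧
      ∀ y, lorForm n (h y) (h y) =
        eucForm (n + 1) y y + (lorForm n (T (P y)) (T (P y)) - eucForm (n + 1) (P y) (P y)) := by
  set B := lorForm n with hB
  set C := eucForm (n + 1) with hC
  have hBsymm : ∀ x y, B x y = B y x := fun x y => (lorForm_isSymm n).eq x y
  have hCsymm : ∀ x y, C x y = C y x := fun x y => (eucForm_isSymm (n + 1)).eq x y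
  obtain ⟨v₀, hv₀, hneg⟩ := hV
  have hBpos : ∀ w ∈ B.orthogonal V, w ≠ 0 → 0 < B w w := fun w hw hne =>
    lorIP_self_pos_of_orthogonal hneg (hw v₀ hv₀) hne
  have hCpos : ∀ w, w ≠ 0 → 0 < C w w := fun w hne => eucIP_self_pos hne
  have hBdisj : Disjoint V (B.orthogonal V) := by
    rw [Submodule.disjoint_def]
    intro x hxV hxW
    by_contra hx
    exact (hBpos x hxW hx).ne' (hxW x hxV)
  have hCdisj : Disjoint V (C.orthogonal V) := by
    rw [Submodule.disjoint_def]
    intro x hxV hxW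
    by_contra hx
    exact (hCpos x hx).ne' (hxW x hxV)
  have hBcompl := (LinearMap.BilinForm.isCompl_orthogonal_iff_disjoint
    (lorForm_isSymm n).isRefl).mpr hBdisj
  have hCcompl := (LinearMap.BilinForm.isCompl_orthogonal_iff_disjoint
    (eucForm_isSymm (n + 1)).isRefl).mpr hCdisj
  have hBV := LinearMap.BilinForm.nondegenerate_restrict_of_disjoint_orthogonal B
    (lorForm_isSymm n).isRefl hBdisj
  have hCV := LinearMap.BilinForm.nondegenerate_restrict_of_disjoint_orthogonal C
    (eucForm_isSymm (n + 1)).isRefl hCdisj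
  let T : V ≃ₗ[ℝ] V := (C.restrict V).toDual hCV ≪≫ₗ ((B.restrict V).toDual hBV).symm
  have hT : ∀ x v : V, B (T x) v = C x v := fun x v =>
    LinearMap.BilinForm.apply_toDual_symm_apply (hB := hBV) ((C.restrict V).toDual hCV x) v
  have hequiv : QuadraticMap.Equivalent
      (C.restrict (C.orthogonal V)).toQuadraticMap (B.restrict (B.orthogonal V)).toQuadraticMap := by
    apply QuadraticForm.PosDef.equivalent
    · intro x hx
      exact hCpos x (by simpa using hx)
    · intro x hx
      exact hBpos x x.2 (by simpa using hx)
    · rw [LinearMap.BilinForm.finrank_orthogonal (lorForm_nondegenerate n),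
        LinearMap.BilinForm.finrank_orthogonal (eucForm_nondegenerate (n + 1))]
  obtain ⟨A⟩ := hequiv
  have hA : ∀ x : C.orthogonal V, B (A x) (A x) = C x x := fun x => A.map_app x
  let eC := Submodule.prodEquivOfIsCompl _ _ hCcompl
  let eB := Submodule.prodEquivOfIsCompl _ _ hBcompl
  let h := eC.symm ≪≫ₗ T.prodCongr A.toLinearEquiv ≪≫ₗ eB
  have hh : ∀ (x : V) (e : C.orthogonal V), h (x + e) = T x + A e := by
    intro x e
    have : eC.symm (x + e) = (x, e) := by
      rw [LinearEquiv.symm_apply_eq]; rfl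
    simp only [h, LinearEquiv.trans_apply, this]
    rfl
  have hP : ∀ (x : V) (e : C.orthogonal V),
      V.projectionOnto (C.orthogonal V) hCcompl (x + e) = x := by
    intro x e
    rw [map_add, Submodule.projectionOnto_apply_left,
      (Submodule.projectionOnto_apply_eq_zero_iff hCcompl).mpr e.2, add_zero]
  have hdecomp : ∀ y : Fin (n + 1) → ℝ, ∃ (x : V) (e : C.orthogonal V), y = x + e := fun y => by
    obtain ⟨⟨x, e⟩, rfl⟩ := eC.surjective y
    exact ⟨x, e, rfl⟩
  refine ⟨h, V.projectionOnto (C.orthogonal V) hCcompl, T, ?_, ?_, ?_⟩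
  all_goals
    intro y
    obtain ⟨x, e, rfl⟩ := hdecomp y
  · intro v hv
    have h1 : B (A e) v = 0 := by rw [hBsymm]; exact (A e).2 v hv
    have h2 : C e v = 0 := by rw [hCsymm]; exact e.2 v hv
    rw [hh, LinearMap.map_add₂, LinearMap.map_add₂, h1, h2, hT x ⟨v, hv⟩]
  · intro v hv
    have h2 : C e v = 0 := by rw [hCsymm]; exact e.2 v hv
    rw [hP, LinearMap.map_add₂, h2, add_zero]
  · have h1 : B (T x) (A e) = 0 := (A e).2 _ (T x).2
    have h2 : C x e = 0 := e.2 _ x.2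
    have h3 : B (A e) (T x) = 0 := by rw [hBsymm, h1]
    have h4 : C e x = 0 := by rw [hCsymm, h2]
    rw [hh, hP]
    simp only [map_add, LinearMap.add_apply, h1, h2, h3, h4, hA, LinearEquiv.coe_coe]
    ring

theorem contDiff_coord_linearMap {m N : ℕ} (L : (Fin m → ℝ) →ₗ[ℝ] (Fin N → ℝ)) (j : Fin N) :
    ContDiff ℝ (⊤ : ℕ∞) fun a => L a j :=
  (LinearMap.toContinuousLinearMap ((LinearMap.proj j).comp L)).contDiff

theorem contDiff_lorForm_comp {m n : ℕ} (L : (Fin m → ℝ) →ₗ[ℝ] (Fin (n + 1) → ℝ)) :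
    ContDiff ℝ (⊤ : ℕ∞) fun a => lorForm n (L a) (L a) := by
  have := contDiff_coord_linearMap L
  simp only [lorForm_apply, lorIP]
  fun_prop

theorem contDiff_eucForm_comp {m N : ℕ} (L : (Fin m → ℝ) →ₗ[ℝ] (Fin N → ℝ)) :
    ContDiff ℝ (⊤ : ℕ∞) fun a => eucForm N (L a) (L a) := by
  have := contDiff_coord_linearMap L
  simp only [eucForm_apply, eucIP]
  fun_prop

/-- If the recognition subspace is time-like, the Lorentzian and Euclidean distance-squared
mappings are `𝒜`-equivalent. -/
theorem aequiv_of_timeLike {k n : ℕ} (p : Fin (k + 1) → Fin (n + 1) → ℝ)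
    (hV : LTimeLike (recSub p)) : AEquiv (LorDSM p) (EucDSM p) := by
  obtain ⟨h, P, T, hh, hP, hQ⟩ := exists_linearEquiv_of_timeLike (recSub p) hV
  have hmem : ∀ i, p i - p 0 ∈ recSub p := fun i => Submodule.subset_span ⟨i, rfl⟩
  let Λ : (Fin (n + 1) → ℝ) →ₗ[ℝ] (Fin (k + 1) → ℝ) :=
    LinearMap.pi fun i => (eucForm (n + 1)).flip (p i - p 0)
  have hΛ : ∀ y i, Λ y i = eucForm _ y (p i - p 0) := fun _ _ => rfl
  obtain ⟨S, hS⟩ := LinearMap.exists_leftInverse_of_injective (Λ.comp (recSub p).subtype) (by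
    rw [LinearMap.ker_eq_bot']
    intro x hx
    have hle : recSub p ≤ LinearMap.ker (eucForm (n + 1) x) := by
      refine Submodule.span_le.mpr ?_
      rintro _ ⟨i, rfl⟩
      exact congrFun hx i
    by_contra hne
    exact (eucIP_self_pos (by simpa using hne)).ne' (hle x.2))
  have hSΛ : ∀ y, S (Λ y) = P y := fun y => by
    have h1 : Λ (P y) = Λ y := funext fun i => hP y _ (hmem i)
    rw [← h1]
    exact LinearMap.congr_fun hS (P y)
  let φ : (Fin (k + 1) → ℝ) → ℝ := fun a =>
    lorForm n (T (S a)) (T (S a)) - eucForm (n + 1) (S a) (S a)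
  have hφ : ContDiff ℝ (⊤ : ℕ∞) φ :=
    (contDiff_lorForm_comp ((recSub p).subtype ∘ₗ T ∘ₗ S)).sub
      (contDiff_eucForm_comp ((recSub p).subtype ∘ₗ S))
  let b : Fin (k + 1) → ℝ := fun i => lorForm n (p i - p 0) (p i - p 0)
  let c : Fin (k + 1) → ℝ := fun i => eucForm _ (p i - p 0) (p i - p 0)
  have hb0 : b 0 = 0 := by simp [b]
  have hc0 : c 0 = 0 := by simp [c]
  let H : (Fin (k + 1) → ℝ) ≃ (Fin (k + 1) → ℝ) :=
    { toFun := fun s i => s i - b i + c i - φ fun j => (s 0 - s j + b j) / 2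
      invFun := fun s i => s i - c i + b i + φ fun j => (s 0 - s j + c j) / 2
      left_inv := fun s => by
        funext i
        simp only [hb0, hc0]
        ring_nf
      right_inv := fun s => by
        funext i
        simp only [hb0, hc0]
        ring_nf }
  let g : (Fin (n + 1) → ℝ) ≃ (Fin (n + 1) → ℝ) :=
    (Equiv.subRight (p 0)).trans (h.toEquiv.trans (Equiv.addRight (p 0)))
  have hH : ∀ s i, H s i = s i - b i + c i - φ fun j => (s 0 - s j + b j) / 2 := fun _ _ => rfl
  have hg : ∀ x, g x - p 0 = h (x - p 0) := fun x => add_sub_cancel_right _ _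
  refine ⟨g, H, ?_, ?_, ?_, ?_, ?_⟩
  · exact ((LinearMap.toContinuousLinearMap h.toLinearMap).contDiff.comp
      (contDiff_id.sub contDiff_const)).add contDiff_const
  · exact ((LinearMap.toContinuousLinearMap h.symm.toLinearMap).contDiff.comp
      (contDiff_id.sub contDiff_const)).add contDiff_const
  · refine contDiff_pi.mpr fun i => ContDiff.sub (by fun_prop) (hφ.comp (by fun_prop))
  · refine contDiff_pi.mpr fun i => ContDiff.add (by fun_prop) (hφ.comp (by fun_prop))
  · funext x i
    have hL : ∀ j, LorDSM p (g x) j = lorForm n (h (x - p 0)) (h (x - p 0)) -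
        2 * eucForm _ (x - p 0) (p j - p 0) + b j := fun j => by
      rw [LorDSM_apply_eq, hg, hh _ _ (hmem j)]
    have ha : (fun j => (LorDSM p (g x) 0 - LorDSM p (g x) j + b j) / 2) = Λ (x - p 0) := by
      funext j
      rw [hL, hL, hb0, hΛ, sub_self, map_zero]
      ring
    have hφΛ : φ (Λ (x - p 0)) = lorForm n (T (P (x - p 0))) (T (P (x - p 0))) -
        eucForm (n + 1) (P (x - p 0)) (P (x - p 0)) := by
      simp only [φ, hSΛ]
    rw [Function.comp_apply, Function.comp_apply, hH, ha, hφΛ, hL, hQ, EucDSM_apply_eq]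
    ring

theorem corollary2_1 (k n : ℕ) (hk : 1 ≤ k) (hkn : k < n)
    (p : Fin (k + 1) → Fin (n + 1) → ℝ)
    (hgen : Module.finrank ℝ (recSub p) = k) :
    AEquiv (LorDSM p) (EucDSM p) ↔ LTimeLike (recSub p) := by
  refine ⟨fun ⟨h, H, _, _, hH, _, heq⟩ => ?_, aequiv_of_timeLike p⟩
  by_contra hV
  refine not_denseRange_EucDSM p ?_
  rw [heq, ← Function.comp_assoc, DenseRange, h.surjective.range_comp]
  exact H.surjective.denseRange.comp (denseRange_LorDSM hkn p hgen hV) hH.continuous
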